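/- Let 𝔤 be a finite-dimensional semisimple Lie algebra over an algebraically closed field k of characteristic 0, with Cartan subalgebra 𝔥, root system R, base Π, positive roots R_+, 𝔫 = ⊕_{α ∈ R_+} 𝔤^α, 𝔟 = 𝔥 ⊕ 𝔫, and Killing form L. Fix nonzero root vectors X_α ∈ 𝔤^α, set u = Σ_{K ∈ 𝒦} X_{−ε_K} where 𝒦 = 𝒦(Π), and let f ∈ 𝔟* be defined by f(x) = L(u, x). Then 𝔟^f = {x ∈ 𝔥 : ε_K(x) = 0 for all K ∈ 𝒦} and [𝔟, 𝔟^f] ∩ 𝔟^f = {0}. -/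

import Mathlib

open Finset Module

open scoped Classical

/-- A reduced crystallographic root system in the `k`-vector space `V`, recorded through
the finite set `roots` of roots, the coroot linear forms `corootForm α = ⟨·, α^∨⟩`, and
the integer Cartan pairing `pairInt β α = ⟨β, α^∨⟩ ∈ ℤ` (meaningful when `α, β` are roots). -/
structure RootSystemData (k V : Type*) [Field k] [CharZero k]
    [AddCommGroup V] [Module k V] where
  /-- the (finite) set of roots -/
  roots : Finset V
  /-- `corootForm α` is the linear form `⟨·, α^∨⟩` associated to the coroot of a root `α` -/
  corootForm : V → V →ₗ[k] k
  /-- the integer `⟨β, α^∨⟩`, recorded as `pairInt β α` -/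
  pairInt : V → V → ℤ
  ne_zero : ∀ α ∈ roots, α ≠ (0 : V)
  span_eq_top : Submodule.span k (roots : Set V) = ⊤
  pair_compat : ∀ α ∈ roots, ∀ β ∈ roots, ((pairInt β α : ℤ) : k) = corootForm α β
  pair_self : ∀ α ∈ roots, pairInt α α = 2
  reflect_mem : ∀ α ∈ roots, ∀ β ∈ roots, β - pairInt β α • α ∈ roots
  reduced : ∀ α ∈ roots, ∀ c : k, c • α ∈ roots → c = 1 ∨ c = -1

namespace RootSystemData

variable {k V : Type*} [Field k] [CharZero k] [AddCommGroup V] [Module k V]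
variable (P : RootSystemData k V)

/-- A base (set of simple roots) of the root system: a linearly independent set of roots
such that every root is a nonnegative or nonpositive integral combination of its elements. -/
structure IsBase (B : Finset V) : Prop where
  subset : B ⊆ P.roots
  indep : LinearIndependent k (fun b : B => (b : V))
  pos_or_neg : ∀ α ∈ P.roots,
    α ∈ AddSubmonoid.closure (B : Set V) ∨ -α ∈ AddSubmonoid.closure (B : Set V)

/-- The positive roots `R₊` with respect to a base `B`. -/
noncomputable def posRoots (B : Finset V) : Finset V :=
  P.roots.filter fun α => α ∈ AddSubmonoid.closure (B : Set V)

/-- `R^S = R ∩ ℤS`. -/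
noncomputable def rootsOf (S : Finset V) : Finset V :=
  P.roots.filter fun α => α ∈ AddSubgroup.closure (S : Set V)

/-- `R₊^S = R ∩ ℕS`. -/
noncomputable def posRootsOf (S : Finset V) : Finset V :=
  P.roots.filter fun α => α ∈ AddSubmonoid.closure (S : Set V)

/-- Two simple roots are linked in the Dynkin diagram of `S ⊆ Π` when they can be joined
by a chain in `S` of consecutively non-orthogonal elements. -/
def Linked (S : Finset V) : V → V → Prop :=
  Relation.ReflTransGen fun a b => a ∈ S ∧ b ∈ S ∧ P.pairInt a b ≠ 0

/-- A subset of a base is connected if its Dynkin diagram is connected (and nonempty). -/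
def IsConnected (S : Finset V) : Prop :=
  S.Nonempty ∧ ∀ a ∈ S, ∀ b ∈ S, P.Linked S a b

/-- `ε` is the highest root of `R^S`: a positive root of `R^S` such that `ε - α ∈ ℕS`
for every root `α ∈ R^S`. -/
def IsHighestRoot (S : Finset V) (ε : V) : Prop :=
  ε ∈ P.posRootsOf S ∧ ∀ α ∈ P.rootsOf S, ε - α ∈ AddSubmonoid.closure (S : Set V)

/-- The highest root `ε_S` of `R^S` (junk value `0` if it does not exist). -/
noncomputable def highestRoot (S : Finset V) : V :=
  if h : ∃ ε, P.IsHighestRoot S ε then h.choose else 0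

/-- The connected component of `a` in the Dynkin diagram of `S`. -/
noncomputable def component (S : Finset V) (a : V) : Finset V :=
  S.filter fun b => P.Linked S a b

/-- The connected components of the Dynkin diagram of `S`. -/
noncomputable def components (S : Finset V) : Finset (Finset V) :=
  S.image fun a => P.component S a

/-- `{α ∈ S : ⟨α, ε_S^∨⟩ = 0}`. -/
noncomputable def zeroPart (S : Finset V) : Finset V :=
  S.filter fun a => P.pairInt a (P.highestRoot S) = 0

/-- Fuel-based auxiliary recursion for the cascade `𝒦(S)`; for an actual root system the
recursion terminates in at most `card S` steps, so fuel `card S + 1` computes `𝒦(S)`. -/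
noncomputable def cascadeAux : ℕ → Finset V → Finset (Finset V)
  | 0, _ => ∅
  | n + 1, S => (P.components S).biUnion fun C => insert C (cascadeAux n (P.zeroPart C))

/-- The cascade `𝒦(S)`, defined recursively by `𝒦(∅) = ∅`,
`𝒦(S) = 𝒦(S₁) ∪ ⋯ ∪ 𝒦(S_r)` if `S` has connected components `S₁, …, S_r`, and
`𝒦(S) = {S} ∪ 𝒦({α ∈ S : ⟨α, ε_S^∨⟩ = 0})` if `S` is connected. -/
noncomputable def cascade (S : Finset V) : Finset (Finset V) :=
  P.cascadeAux (S.card + 1) S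

/-- `Γ^K = {α ∈ R^K : ⟨α, ε_K^∨⟩ > 0}`. -/
noncomputable def gamma (K : Finset V) : Finset V :=
  (P.rootsOf K).filter fun α => 0 < P.pairInt α (P.highestRoot K)

end RootSystemData

/-- For a Lie subalgebra `𝔮` of a Lie algebra and a linear form `f ∈ 𝔮*`, the subspace
`𝔮^f = {x ∈ 𝔮 : f ⁅x, y⁆ = 0 for all y ∈ 𝔮}`. -/
def lieSubFix {k g : Type*} [Field k] [LieRing g] [LieAlgebra k g]
    (q : LieSubalgebra k g) (f : Module.Dual k q) : Submodule k q where
  carrier := {x : q | ∀ y : q, f ⁅x, y⁆ = 0}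
  add_mem' := fun hx hy z => by rw [add_lie, map_add, hx z, hy z, add_zero]
  zero_mem' := fun z => by rw [zero_lie, map_zero]
  smul_mem' := fun c x hx z => by rw [smul_lie, map_smul, hx z, smul_zero]

namespace RootSystemData

section Comb

variable {k V : Type*} [Field k] [CharZero k] [AddCommGroup V] [Module k V]

/-- The classical facts about pairs of roots which are used below. -/
structure Good (P : RootSystemData k V) : Prop where
  sub : ∀ α ∈ P.roots, ∀ β ∈ P.roots, 0 < P.pairInt α β → α ≠ β → α - β ∈ P.roots
  symm_pos : ∀ α ∈ P.roots, ∀ β ∈ P.roots, 0 < P.pairInt α β → 0 < P.pairInt β α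
  symm_zero : ∀ α ∈ P.roots, ∀ β ∈ P.roots, P.pairInt α β = 0 → P.pairInt β α = 0

variable {P : RootSystemData k V} {Δ : Finset V}

lemma neg_mem {α : V} (h : α ∈ P.roots) : -α ∈ P.roots := by
  have := P.reflect_mem α h α h
  rw [P.pair_self α h] at this
  convert this using 1
  rw [two_zsmul]; abel

lemma pair_neg {α β : V} (h : α ∈ P.roots) (hβ : β ∈ P.roots) :
    P.pairInt (-α) β = -P.pairInt α β := by
  have : ((P.pairInt (-α) β : ℤ) : k) = ((-P.pairInt α β : ℤ) : k) := by
    rw [P.pair_compat _ hβ _ (neg_mem h), Int.cast_neg, P.pair_compat _ hβ _ h, map_neg]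
  exact_mod_cast this

lemma pair_add {α α' β : V} (h : α ∈ P.roots) (h' : α' ∈ P.roots) (hs : α + α' ∈ P.roots)
    (hβ : β ∈ P.roots) :
    P.pairInt (α + α') β = P.pairInt α β + P.pairInt α' β := by
  have : ((P.pairInt (α + α') β : ℤ) : k) = ((P.pairInt α β + P.pairInt α' β : ℤ) : k) := by
    rw [P.pair_compat _ hβ _ hs, Int.cast_add, P.pair_compat _ hβ _ h, P.pair_compat _ hβ _ h',
      map_add]
  exact_mod_cast this

lemma pair_sum {S : Finset V} (hS : S ⊆ P.roots) {n : V → ℕ} {x β : V} (hx : x ∈ P.roots)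
    (hxs : x = ∑ a ∈ S, n a • a) (hβ : β ∈ P.roots) :
    P.pairInt x β = ∑ a ∈ S, (n a : ℤ) * P.pairInt a β := by
  have : ((P.pairInt x β : ℤ) : k) = ((∑ a ∈ S, (n a : ℤ) * P.pairInt a β : ℤ) : k) := by
    rw [P.pair_compat _ hβ _ hx]
    conv_lhs => rw [hxs]
    rw [map_sum, Int.cast_sum]
    refine Finset.sum_congr rfl fun a ha => ?_
    rw [map_nsmul, Int.cast_mul, P.pair_compat _ hβ _ (hS ha)]
    simp
  exact_mod_cast this

/-- shorthand for `ℕS` -/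
abbrev NN (S : Finset V) : AddSubmonoid V := AddSubmonoid.closure (S : Set V)

lemma mem_NN {S : Finset V} {x : V} : x ∈ NN S ↔ ∃ n : V → ℕ, x = ∑ a ∈ S, n a • a := by
  constructor
  · intro h
    obtain ⟨n, -, hn⟩ := AddSubmonoid.mem_closure_finset.mp h
    exact ⟨n, hn.symm⟩
  · rintro ⟨n, rfl⟩
    exact AddSubmonoid.sum_mem _ fun a ha =>
      AddSubmonoid.nsmul_mem _ (AddSubmonoid.subset_closure ha) _

lemma NN_mono {S T : Finset V} (h : S ⊆ T) : NN S ≤ NN T :=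
  AddSubmonoid.closure_mono (by exact_mod_cast h)

lemma exists_co (hB : P.IsBase Δ) : ∃ co : V → V →ₗ[k] k,
    ∀ a ∈ Δ, ∀ b ∈ Δ, co a b = if b = a then 1 else 0 := by
  have hsp : ⊤ ≤ Submodule.span k (Set.range fun b : Δ => (b : V)) := by
    rw [← P.span_eq_top, Submodule.span_le]
    have key : ∀ x ∈ NN Δ, x ∈ Submodule.span k (Set.range fun b : Δ => (b : V)) := by
      intro x hx
      refine AddSubmonoid.closure_induction (fun y hy => Submodule.subset_span ⟨⟨y, hy⟩, rfl⟩)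
        (Submodule.zero_mem _) (fun y z _ _ h1 h2 => Submodule.add_mem _ h1 h2) hx
    intro α hα
    rcases hB.pos_or_neg α hα with h | h
    · exact key _ h
    · exact (Submodule.neg_mem_iff _).mp (key _ h)
  let B := Basis.mk hB.indep hsp
  refine ⟨fun a => if h : a ∈ Δ then B.coord ⟨a, h⟩ else 0, fun a ha b hb => ?_⟩
  have : b = B ⟨b, hb⟩ := by simp [B]
  simp only [ha, dif_pos, Basis.coord_apply]
  conv_lhs => rw [this]
  rw [Basis.repr_self, Finsupp.single_apply]
  simp

lemma co_sum {co : V → V →ₗ[k] k} (hco : ∀ a ∈ Δ, ∀ b ∈ Δ, co a b = if b = a then 1 else 0)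
    {S : Finset V} (hS : S ⊆ Δ) (n : V → ℕ) {a : V} (ha : a ∈ Δ) :
    co a (∑ b ∈ S, n b • b) = if a ∈ S then (n a : k) else 0 := by
  rw [map_sum]
  have : ∀ b ∈ S, co a (n b • b) = if b = a then (n b : k) else 0 := by
    intro b hb
    rw [map_nsmul, hco a ha b (hS hb)]; split_ifs <;> simp
  rw [Finset.sum_congr rfl this, Finset.sum_ite_eq']

lemma eq_of_co {co : V → V →ₗ[k] k} (hco : ∀ a ∈ Δ, ∀ b ∈ Δ, co a b = if b = a then 1 else 0)
    {S : Finset V} (hS : S ⊆ Δ) {x : V} (hx : x ∈ NN Δ) (h : ∀ a ∈ Δ, a ∉ S → co a x = 0) :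
    x ∈ NN S := by
  obtain ⟨n, rfl⟩ := mem_NN.mp hx
  rw [mem_NN]
  refine ⟨n, (Finset.sum_subset hS fun a ha haS => ?_).symm⟩
  have := h a ha haS
  rw [co_sum hco subset_rfl n ha, if_pos ha] at this
  rw [Nat.cast_eq_zero.mp this, zero_smul]

lemma NN_antisymm (hB : P.IsBase Δ) {x : V} (h1 : x ∈ NN Δ) (h2 : -x ∈ NN Δ) : x = 0 := by
  obtain ⟨co, hco⟩ := exists_co hB
  obtain ⟨n, hn⟩ := mem_NN.mp h1
  obtain ⟨m, hm⟩ := mem_NN.mp h2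
  rw [hn]
  refine Finset.sum_eq_zero fun a ha => ?_
  have e1 := co_sum hco subset_rfl n ha
  have e2 := co_sum hco subset_rfl m ha
  rw [← hn, if_pos ha] at e1
  rw [← hm, if_pos ha, map_neg, e1] at e2
  have : (n a : k) + m a = 0 := by rw [← e2]; ring
  have : n a + m a = 0 := by exact_mod_cast this
  rw [show n a = 0 by omega, zero_smul]

lemma NN_of_add (hB : P.IsBase Δ) {S : Finset V} (hS : S ⊆ Δ) {x y : V} (hx : x ∈ NN Δ)
    (hy : y ∈ NN Δ) (h : x + y ∈ NN S) : x ∈ NN S := by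
  obtain ⟨co, hco⟩ := exists_co hB
  refine eq_of_co hco hS hx fun a ha haS => ?_
  obtain ⟨n, hn⟩ := mem_NN.mp hx
  obtain ⟨m, hm⟩ := mem_NN.mp hy
  obtain ⟨p, hp⟩ := mem_NN.mp h
  have e1 := co_sum hco subset_rfl n ha
  have e2 := co_sum hco subset_rfl m ha
  have e3 := co_sum hco hS p ha
  rw [← hn, if_pos ha] at e1
  rw [← hm, if_pos ha] at e2
  rw [← hp, if_neg haS, map_add, e1, e2] at e3
  have : n a + m a = 0 := by exact_mod_cast e3
  rw [e1, show n a = 0 by omega, Nat.cast_zero]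

lemma pos_or_neg_of (hB : P.IsBase Δ) {S : Finset V} (hS : S ⊆ Δ) {α : V} (hα : α ∈ P.rootsOf S) :
    α ∈ NN S ∨ -α ∈ NN S := by
  obtain ⟨co, hco⟩ := exists_co hB
  rw [rootsOf, Finset.mem_filter] at hα
  have h0 : ∀ a ∈ Δ, a ∉ S → co a α = 0 := by
    intro a ha haS
    refine AddSubgroup.closure_induction (p := fun x _ => co a x = 0) (fun y hy => ?_) (map_zero _)
      (fun y z _ _ h1 h2 => by rw [map_add, h1, h2, add_zero])
      (fun y _ h1 => by rw [map_neg, h1, neg_zero]) hα.2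
    rw [hco a ha y (hS hy), if_neg]
    rintro rfl; exact haS hy
  rcases hB.pos_or_neg α hα.1 with h | h
  · exact Or.inl (eq_of_co hco hS h h0)
  · exact Or.inr (eq_of_co hco hS h fun a ha haS => by rw [map_neg, h0 a ha haS, neg_zero])

lemma NN_le_ZZ (S : Finset V) {x : V} (hx : x ∈ NN S) : x ∈ AddSubgroup.closure (S : Set V) :=
  AddSubmonoid.closure_induction (fun _ hy => AddSubgroup.subset_closure hy)
    (AddSubgroup.zero_mem _) (fun _ _ _ _ h1 h2 => AddSubgroup.add_mem _ h1 h2) hx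

lemma pair_nonpos (hG : P.Good) (hB : P.IsBase Δ) {a b : V} (ha : a ∈ Δ) (hb : b ∈ Δ)
    (hab : a ≠ b) : P.pairInt a b ≤ 0 := by
  by_contra hcon
  have hr := hG.sub a (hB.subset ha) b (hB.subset hb) (by omega) hab
  obtain ⟨co, hco⟩ := exists_co hB
  have key : ∀ a ∈ Δ, ∀ b ∈ Δ, a ≠ b → a - b ∉ NN Δ := by
    intro a ha b hb hab h
    obtain ⟨n, hn⟩ := mem_NN.mp h
    have e1 := co_sum hco subset_rfl n hb
    rw [← hn, if_pos hb, map_sub, hco b hb a ha, hco b hb b hb, if_neg hab, if_pos rfl] at e1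
    have : (n b : k) + 1 = 0 := by rw [← e1]; ring
    exact Nat.cast_add_one_ne_zero _ this
  rcases hB.pos_or_neg _ hr with h | h
  · exact key a ha b hb hab h
  · rw [neg_sub] at h; exact key b hb a ha hab.symm h

lemma simple_not_neg (hB : P.IsBase Δ) {a : V} (ha : a ∈ Δ) : -a ∉ NN Δ := fun h =>
  P.ne_zero a (hB.subset ha) (NN_antisymm hB (AddSubmonoid.subset_closure ha) h)

/-- well-foundedness of the strict order attached to `ℕΔ` on the roots, both ways. -/
lemma wf_lt (hB : P.IsBase Δ) :
    WellFounded (fun a b : P.roots => (b : V) ≠ a ∧ (b : V) - a ∈ NN Δ) := by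
  haveI : IsTrans P.roots (fun a b : P.roots => (b : V) ≠ a ∧ (b : V) - a ∈ NN Δ) := by
    refine ⟨fun a b c h1 h2 => ⟨fun h => ?_, ?_⟩⟩
    · refine h1.1 (sub_eq_zero.mp (NN_antisymm hB h1.2 ?_))
      rw [neg_sub, ← h]; exact h2.2
    · have := AddSubmonoid.add_mem _ h2.2 h1.2
      simpa using this
  haveI : Std.Irrefl (fun a b : P.roots => (b : V) ≠ a ∧ (b : V) - a ∈ NN Δ) :=
    ⟨fun a h => h.1 rfl⟩
  exact Finite.wellFounded_of_trans_of_irrefl _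

lemma wf_gt (hB : P.IsBase Δ) :
    WellFounded (fun a b : P.roots => (a : V) ≠ b ∧ (a : V) - b ∈ NN Δ) := by
  haveI : IsTrans P.roots (fun a b : P.roots => (a : V) ≠ b ∧ (a : V) - b ∈ NN Δ) := by
    refine ⟨fun a b c h1 h2 => ⟨fun h => ?_, ?_⟩⟩
    · refine h1.1 (sub_eq_zero.mp (NN_antisymm hB h1.2 ?_))
      rw [neg_sub, h]; exact h2.2
    · have := AddSubmonoid.add_mem _ h1.2 h2.2
      simpa using this
  haveI : Std.Irrefl (fun a b : P.roots => (a : V) ≠ b ∧ (a : V) - b ∈ NN Δ) :=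
    ⟨fun a h => h.1 rfl⟩
  exact Finite.wellFounded_of_trans_of_irrefl _

/-! ### Components -/

lemma linked_symm (hG : P.Good) {S : Finset V} (hS : S ⊆ P.roots) {a b : V}
    (h : P.Linked S a b) : P.Linked S b a := by
  unfold Linked at *
  induction h with
  | refl => exact Relation.ReflTransGen.refl
  | tail _ h2 ih =>
    refine Relation.ReflTransGen.head ⟨h2.2.1, h2.1, fun h => h2.2.2 ?_⟩ ih
    exact hG.symm_zero _ (hS h2.2.1) _ (hS h2.1) h

lemma component_subset (S : Finset V) (c : V) : P.component S c ⊆ S := Finset.filter_subset _ _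

lemma component_step {S : Finset V} {c a b : V} (ha : a ∈ P.component S c) (hb : b ∈ S)
    (h : P.pairInt a b ≠ 0) : b ∈ P.component S c := by
  rw [component, Finset.mem_filter] at *
  exact ⟨hb, ha.2.tail ⟨ha.1, hb, h⟩⟩

lemma component_connected (hG : P.Good) {S : Finset V} (hS : S ⊆ P.roots) {c : V} (hc : c ∈ S) :
    P.IsConnected (P.component S c) := by
  have hcc : c ∈ P.component S c := Finset.mem_filter.mpr ⟨hc, Relation.ReflTransGen.refl⟩
  have key : ∀ a ∈ P.component S c, P.Linked (P.component S c) c a := by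
    intro a ha
    have h := (Finset.mem_filter.mp ha).2
    unfold Linked at h
    induction h with
    | refl => exact Relation.ReflTransGen.refl
    | @tail b d h1 h2 ih =>
      have hb : b ∈ P.component S c := Finset.mem_filter.mpr ⟨h2.1, h1⟩
      exact (ih hb).tail ⟨hb, ha, h2.2.2⟩
  refine ⟨⟨c, hcc⟩, fun a ha b hb => ?_⟩
  exact (linked_symm hG ((component_subset S c).trans hS) (key a ha)).trans (key b hb)

lemma component_orth (hG : P.Good) {S : Finset V} (hS : S ⊆ P.roots) {c d a b : V}
    (hcd : P.component S c ≠ P.component S d)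
    (ha : a ∈ P.component S c) (hb : b ∈ P.component S d) : P.pairInt a b = 0 := by
  by_contra h
  apply hcd
  have hb' := component_step ha (component_subset _ _ hb) h
  have h1 := (Finset.mem_filter.mp hb).2
  have h2 := (Finset.mem_filter.mp hb').2
  ext e
  simp only [component, Finset.mem_filter]
  constructor
  · rintro ⟨he, h3⟩
    exact ⟨he, (h1.trans (linked_symm hG hS h2)).trans h3⟩
  · rintro ⟨he, h3⟩
    exact ⟨he, (h2.trans (linked_symm hG hS h1)).trans h3⟩

lemma mem_component_of_pos (hG : P.Good) (hB : P.IsBase Δ) {S : Finset V} (hS : S ⊆ Δ)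
    (α : P.roots) : (α : V) ∈ NN S → ∃ c ∈ S, (α : V) ∈ NN (P.component S c) := by
  induction α using (wf_lt hB).induction with
  | _ α ih =>
  intro hα
  have hSr := hS.trans hB.subset
  obtain ⟨n, hn⟩ := mem_NN.mp hα
  have h2 := pair_sum hSr α.2 hn α.2
  rw [P.pair_self _ α.2] at h2
  obtain ⟨a, ha, hpos⟩ : ∃ a ∈ S, 0 < (n a : ℤ) * P.pairInt a α := by
    by_contra! hcon
    have := Finset.sum_nonpos hcon
    omega
  have hna : 0 < n a := by
    rcases Nat.eq_zero_or_pos (n a) with h | h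
    · rw [h] at hpos; simp at hpos
    · exact h
  have hp : 0 < P.pairInt a α := by
    by_contra h; push Not at h
    have := mul_nonpos_of_nonneg_of_nonpos (Int.natCast_nonneg (n a)) h
    omega
  have haR := hSr ha
  have hp' := hG.symm_pos _ haR _ α.2 hp
  by_cases hαa : (α : V) = a
  · refine ⟨a, ha, ?_⟩
    rw [hαa]
    exact AddSubmonoid.subset_closure (Finset.mem_filter.mpr ⟨ha, Relation.ReflTransGen.refl⟩)
  have hr := hG.sub _ α.2 _ haR hp' hαa
  have hsub : (α : V) - a ∈ NN S := by
    rw [hn, ← Finset.add_sum_erase _ _ ha]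
    have e : n a • a + ∑ x ∈ S.erase a, n x • x - a
        = (n a - 1) • a + ∑ x ∈ S.erase a, n x • x := by
      obtain ⟨m, hm⟩ : ∃ m, n a = m + 1 := ⟨n a - 1, by omega⟩
      rw [hm, Nat.add_sub_cancel, add_smul, one_smul]; abel
    rw [e]
    refine AddSubmonoid.add_mem _ (AddSubmonoid.nsmul_mem _ (AddSubmonoid.subset_closure ha) _)
      (AddSubmonoid.sum_mem _ fun x hx => AddSubmonoid.nsmul_mem _
        (AddSubmonoid.subset_closure (Finset.mem_of_mem_erase hx)) _)
  obtain ⟨c, hc, hmem⟩ := ih ⟨(α : V) - a, hr⟩ ⟨fun h => P.ne_zero a haR (sub_eq_self.mp h.symm), by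
    simpa using AddSubmonoid.subset_closure (hS ha)⟩ hsub
  refine ⟨c, hc, ?_⟩
  by_cases hac : a ∈ P.component S c
  · have := AddSubmonoid.add_mem _ hmem (AddSubmonoid.subset_closure hac)
    simpa using this
  exfalso
  have hCΔ := (component_subset (P := P) S c).trans hS
  simp only at hmem
  obtain ⟨m, hm⟩ := mem_NN.mp hmem
  have h0 : P.pairInt ((α : V) - a) a = 0 := by
    rw [pair_sum (hCΔ.trans hB.subset) hr hm haR]
    refine Finset.sum_eq_zero fun d hd => ?_
    have : P.pairInt d a = 0 := by
      by_contra h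
      exact hac (component_step hd ha h)
    rw [this, mul_zero]
  have href := P.reflect_mem a haR (α : V) α.2
  have h1 : P.pairInt (α : V) a = 2 := by
    have := pair_add hr haR (by simpa using α.2) haR
    rw [sub_add_cancel, h0, P.pair_self a haR] at this
    omega
  rw [h1] at href
  obtain ⟨co, hco⟩ := exists_co hB
  have haΔ := hS ha
  have e1 : co a ((α : V) - a) = 0 := by
    rw [hm, co_sum hco hCΔ m haΔ, if_neg hac]
  have e2 : co a ((α : V) - (2 : ℤ) • a) = -1 := by
    rw [show (α : V) - (2 : ℤ) • a = ((α : V) - a) - a by rw [two_zsmul]; abel, map_sub, e1,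
      hco a haΔ a haΔ, if_pos rfl, zero_sub]
  rcases hB.pos_or_neg _ href with h | h
  · obtain ⟨p, hp⟩ := mem_NN.mp h
    have e3 := co_sum hco subset_rfl p haΔ
    rw [← hp, e2, if_pos haΔ] at e3
    have : (p a : k) + 1 = 0 := by rw [← e3]; ring
    exact Nat.cast_add_one_ne_zero _ this
  · have h3 : a - ((α : V) - a) ∈ NN Δ := by
      convert h using 1
      rw [two_zsmul]; abel
    have h4 : ((α : V) - a) + (a - ((α : V) - a)) ∈ NN {a} := by
      rw [add_sub_cancel]; exact AddSubmonoid.subset_closure (by simp)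
    have h5 := NN_of_add hB (S := {a}) (by simpa using haΔ) (NN_mono hS hsub) h3 h4
    obtain ⟨q, hq⟩ := mem_NN.mp h5
    rw [Finset.sum_singleton] at hq
    rw [hq, map_nsmul, hco a haΔ a haΔ, if_pos rfl] at e1
    have : q a = 0 := by simpa using e1
    rw [this, zero_smul] at hq
    exact hαa (sub_eq_zero.mp hq)

/-! ### Highest roots -/

lemma exists_highest (hG : P.Good) (hB : P.IsBase Δ) {S : Finset V} (hS : S ⊆ Δ)
    (hc : P.IsConnected S) : ∃ ε, P.IsHighestRoot S ε := by
  have hSr := hS.trans hB.subset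
  -- maximal elements
  have hmax : ∀ α ∈ P.rootsOf S, ∃ ε ∈ P.rootsOf S, ε - α ∈ NN S ∧
      ∀ γ ∈ P.rootsOf S, γ - ε ∈ NN S → γ = ε := by
    intro α hα
    have hα' := (Finset.mem_filter.mp hα).1
    let T : Set P.roots := {γ | (γ : V) ∈ P.rootsOf S ∧ (γ : V) - α ∈ NN S}
    have hT : T.Nonempty := ⟨⟨α, hα'⟩, hα, by simp⟩
    obtain ⟨ε, hε, hm⟩ := (wf_gt hB).has_min T hT
    refine ⟨ε, hε.1, hε.2, fun γ hγ hγε => ?_⟩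
    by_contra hne
    refine hm ⟨γ, (Finset.mem_filter.mp hγ).1⟩ ⟨hγ, ?_⟩ ⟨hne, NN_mono hS hγε⟩
    have := AddSubmonoid.add_mem _ hγε hε.2
    simpa using this
  -- properties of maximal elements
  have hpos : ∀ ε ∈ P.rootsOf S, (∀ γ ∈ P.rootsOf S, γ - ε ∈ NN S → γ = ε) → ε ∈ NN S := by
    intro ε hε hm
    rcases pos_or_neg_of hB hS hε with h | h
    · exact h
    exfalso
    obtain ⟨h1, h2⟩ := Finset.mem_filter.mp hε
    have h3 : -ε ∈ P.rootsOf S := Finset.mem_filter.mpr ⟨neg_mem h1, AddSubgroup.neg_mem _ h2⟩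
    have h4 := hm _ h3 (by simpa [sub_eq_add_neg] using AddSubmonoid.add_mem _ h h)
    refine P.ne_zero ε h1 (NN_antisymm hB ?_ (NN_mono hS h))
    rw [← h4]; exact NN_mono hS h
  have hdom : ∀ ε ∈ P.rootsOf S, (∀ γ ∈ P.rootsOf S, γ - ε ∈ NN S → γ = ε) →
      ∀ a ∈ S, 0 ≤ P.pairInt a ε := by
    intro ε hε hm a ha
    by_contra hlt
    push Not at hlt
    obtain ⟨h1, h2⟩ := Finset.mem_filter.mp hε
    have haR := hSr ha
    have hna := pair_neg haR h1
    have hne : -a ≠ ε := by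
      rintro rfl
      exact simple_not_neg hB (hS ha) (NN_mono hS (hpos _ hε hm))
    have hr := hG.sub _ (neg_mem haR) _ h1 (by omega) hne
    have hr2 := neg_mem hr
    rw [neg_sub, sub_neg_eq_add] at hr2
    have h5 : ε + a ∈ P.rootsOf S := Finset.mem_filter.mpr
      ⟨hr2, AddSubgroup.add_mem _ h2 (AddSubgroup.subset_closure ha)⟩
    have h6 := hm _ h5 (by simpa using AddSubmonoid.subset_closure ha)
    exact P.ne_zero a haR (by simpa using h6)
  have hfull : ∀ ε ∈ P.rootsOf S, (∀ γ ∈ P.rootsOf S, γ - ε ∈ NN S → γ = ε) →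
      ∀ n : V → ℕ, ε = ∑ a ∈ S, n a • a → ∀ a ∈ S, 0 < n a := by
    intro ε hε hm n hn a ha
    have h1 := (Finset.mem_filter.mp hε).1
    obtain ⟨b, hb, hnb⟩ : ∃ b ∈ S, 0 < n b := by
      by_contra! hcon
      apply P.ne_zero ε h1
      rw [hn]
      refine Finset.sum_eq_zero fun b hb => ?_
      rw [show n b = 0 by have := hcon b hb; omega, zero_smul]
    have hl := hc.2 b hb a ha
    unfold Linked at hl
    clear ha
    induction hl with
    | refl => exact hnb
    | @tail c d _ h2 ih =>
      by_contra hd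
      have hdR := hSr h2.2.1
      have hcR := hSr h2.1
      have hdc : P.pairInt c d ≠ 0 := h2.2.2
      have e := pair_sum hSr h1 hn hdR
      have hle : ∀ x ∈ S, (n x : ℤ) * P.pairInt x d ≤ 0 := by
        intro x hx
        by_cases hxd : x = d
        · rw [hxd, show n d = 0 by omega]; simp
        · exact mul_nonpos_of_nonneg_of_nonpos (Int.natCast_nonneg _)
            (pair_nonpos hG hB (hS hx) (hS h2.2.1) hxd)
      have hlt : (n c : ℤ) * P.pairInt c d < 0 := by
        refine mul_neg_of_pos_of_neg (by exact_mod_cast ih) (lt_of_le_of_ne ?_ hdc)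
        refine pair_nonpos hG hB (hS h2.1) (hS h2.2.1) ?_
        rintro rfl; omega
      have hsum : P.pairInt ε d < 0 := by
        rw [e]; exact Finset.sum_neg' hle ⟨c, h2.1, hlt⟩
      have hd0 := hdom ε hε hm d h2.2.1
      rcases hd0.lt_or_eq with h | h
      · have := hG.symm_pos _ hdR _ h1 h; omega
      · have := hG.symm_zero _ hdR _ h1 h.symm; omega
  -- uniqueness
  have huniq : ∀ ε ∈ P.rootsOf S, (∀ γ ∈ P.rootsOf S, γ - ε ∈ NN S → γ = ε) →
      ∀ δ ∈ P.rootsOf S, (∀ γ ∈ P.rootsOf S, γ - δ ∈ NN S → γ = δ) → ε = δ := by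
    intro ε hε hm δ hδ hmδ
    by_contra hne
    obtain ⟨h1, h1'⟩ := Finset.mem_filter.mp hε
    obtain ⟨h2, h2'⟩ := Finset.mem_filter.mp hδ
    obtain ⟨n, hn⟩ := mem_NN.mp (hpos ε hε hm)
    obtain ⟨m, hmm⟩ := mem_NN.mp (hpos δ hδ hmδ)
    have e1 := pair_sum hSr h1 hn h2
    have e2 := pair_sum hSr h2 hmm h2
    rw [P.pair_self _ h2] at e2
    obtain ⟨a, ha, hapos⟩ : ∃ a ∈ S, 0 < P.pairInt a δ := by
      by_contra! hcon
      have : ∑ a ∈ S, (m a : ℤ) * P.pairInt a δ ≤ 0 := Finset.sum_nonpos fun a ha =>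
        mul_nonpos_of_nonneg_of_nonpos (Int.natCast_nonneg _) (hcon a ha)
      omega
    have hp : 0 < P.pairInt ε δ := by
      rw [e1]
      refine Finset.sum_pos' (fun x hx => mul_nonneg (Int.natCast_nonneg _)
        (hdom δ hδ hmδ x hx)) ⟨a, ha, mul_pos ?_ hapos⟩
      exact_mod_cast hfull ε hε hm n hn a ha
    have hr := hG.sub _ h1 _ h2 hp hne
    have hr' : ε - δ ∈ P.rootsOf S := Finset.mem_filter.mpr ⟨hr, AddSubgroup.sub_mem _ h1' h2'⟩
    rcases pos_or_neg_of hB hS hr' with h | h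
    · exact hne (hmδ ε hε h)
    · rw [neg_sub] at h; exact hne (hm δ hδ h).symm
  obtain ⟨a, ha⟩ := hc.1
  obtain ⟨ε, hε, -, hm⟩ := hmax a (Finset.mem_filter.mpr
    ⟨hSr ha, AddSubgroup.subset_closure ha⟩)
  refine ⟨ε, Finset.mem_filter.mpr ⟨(Finset.mem_filter.mp hε).1, hpos ε hε hm⟩, fun α hα => ?_⟩
  obtain ⟨δ, hδ, hδα, hmδ⟩ := hmax α hα
  rw [huniq ε hε hm δ hδ hmδ]
  exact hδα

lemma highest_spec (hG : P.Good) (hB : P.IsBase Δ) {S : Finset V} (hS : S ⊆ Δ)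
    (hc : P.IsConnected S) : P.IsHighestRoot S (P.highestRoot S) := by
  have h := exists_highest hG hB hS hc
  rw [highestRoot, dif_pos h]
  exact h.choose_spec

lemma highest_dom (hG : P.Good) (hB : P.IsBase Δ) {S : Finset V} (hS : S ⊆ Δ)
    {ε : V} (h : P.IsHighestRoot S ε) {a : V} (ha : a ∈ S) : 0 ≤ P.pairInt a ε := by
  obtain ⟨h1, h2⟩ := Finset.mem_filter.mp h.1
  by_contra hlt
  push Not at hlt
  have haR := hB.subset (hS ha)
  have hna := pair_neg haR h1
  have hne : -a ≠ ε := by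
    rintro rfl
    exact simple_not_neg hB (hS ha) (NN_mono hS h2)
  have hr2 := neg_mem (hG.sub _ (neg_mem haR) _ h1 (by omega) hne)
  rw [neg_sub, sub_neg_eq_add] at hr2
  have h5 : ε + a ∈ P.rootsOf S := Finset.mem_filter.mpr
    ⟨hr2, AddSubgroup.add_mem _ (NN_le_ZZ S h2) (AddSubgroup.subset_closure ha)⟩
  have h6 := h.2 _ h5
  rw [sub_add_cancel_left] at h6
  exact simple_not_neg hB (hS ha) (NN_mono hS h6)

lemma highest_dom' (hG : P.Good) (hB : P.IsBase Δ) {S : Finset V} (hS : S ⊆ Δ)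
    {ε : V} (h : P.IsHighestRoot S ε) {α : V} (hα : α ∈ P.roots) (hαS : α ∈ NN S) :
    0 ≤ P.pairInt α ε := by
  obtain ⟨n, hn⟩ := mem_NN.mp hαS
  rw [pair_sum (hS.trans hB.subset) hα hn (Finset.mem_filter.mp h.1).1]
  exact Finset.sum_nonneg fun a ha => mul_nonneg (Int.natCast_nonneg _) (highest_dom hG hB hS h ha)

/-- If `α + β = ε_S` with `α, β` positive roots then `⟨α, ε_S^∨⟩ > 0`. -/
lemma highest_add (hG : P.Good) (hB : P.IsBase Δ) {S : Finset V} (hS : S ⊆ Δ)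
    {ε : V} (h : P.IsHighestRoot S ε) {α β : V} (hα : α ∈ P.roots) (hβ : β ∈ P.roots)
    (hα' : α ∈ NN Δ) (hβ' : β ∈ NN Δ) (hs : α + β = ε) :
    α ∈ NN S ∧ 0 < P.pairInt α ε := by
  obtain ⟨h1, h2⟩ := Finset.mem_filter.mp h.1
  have hαS : α ∈ NN S := NN_of_add hB hS hα' hβ' (by rw [hs]; exact h2)
  have hβS : β ∈ NN S := NN_of_add hB hS hβ' hα' (by rw [add_comm, hs]; exact h2)
  refine ⟨hαS, lt_of_le_of_ne (highest_dom' hG hB hS h hα hαS) fun h0 => ?_⟩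
  have e := pair_add hα hβ (by rw [hs]; exact h1) h1
  rw [hs, P.pair_self _ h1, ← h0, zero_add] at e
  have hr := neg_mem (P.reflect_mem ε h1 β hβ)
  rw [← e, neg_sub] at hr
  have hr' : (2 : ℤ) • ε - β ∈ P.rootsOf S := Finset.mem_filter.mpr ⟨hr, AddSubgroup.sub_mem _
    (AddSubgroup.zsmul_mem _ (NN_le_ZZ S h2) _) (NN_le_ZZ S hβS)⟩
  have h6 := h.2 _ hr'
  have e2 : ε - ((2 : ℤ) • ε - β) = -α := by rw [two_zsmul, ← hs]; abel
  rw [e2] at h6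
  exact P.ne_zero α hα (NN_antisymm hB hα' (NN_mono hS h6))

/-! ### The cascade -/

lemma zeroPart_subset (S : Finset V) : P.zeroPart S ⊆ S := Finset.filter_subset _ _

lemma mem_cascadeAux_succ {n : ℕ} {S K : Finset V} : K ∈ P.cascadeAux (n + 1) S ↔
    ∃ c ∈ S, K = P.component S c ∨ K ∈ P.cascadeAux n (P.zeroPart (P.component S c)) := by
  simp [cascadeAux, components]

lemma cascade_sub (hG : P.Good) (n : ℕ) : ∀ {S K : Finset V}, S ⊆ P.roots →
    K ∈ P.cascadeAux n S → K ⊆ S ∧ P.IsConnected K := by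
  induction n with
  | zero => intro S K _ h; simp [cascadeAux] at h
  | succ n ih =>
    intro S K hS h
    obtain ⟨c, hc, rfl | h⟩ := mem_cascadeAux_succ.mp h
    · exact ⟨component_subset _ _, component_connected hG hS hc⟩
    · have hsub := (zeroPart_subset (P := P) _).trans (component_subset (P := P) S c)
      obtain ⟨h1, h2⟩ := ih (hsub.trans hS) h
      exact ⟨h1.trans hsub, h2⟩

lemma cascade_cover (hG : P.Good) (hB : P.IsBase Δ) (n : ℕ) : ∀ {S : Finset V}, S ⊆ Δ →
    S.card < n → ∀ α ∈ P.roots, α ∈ NN S →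
    ∃ K ∈ P.cascadeAux n S, α ∈ NN K ∧ 0 < P.pairInt α (P.highestRoot K) := by
  induction n with
  | zero => intro S _ h; omega
  | succ n ih =>
    intro S hS hcard α hα hαS
    obtain ⟨c, hc, hαC⟩ := mem_component_of_pos hG hB hS ⟨α, hα⟩ hαS
    simp only at hαC
    set C := P.component S c with hC
    have hCS : C ⊆ S := component_subset S c
    have hCΔ := hCS.trans hS
    have hh := highest_spec hG hB hCΔ (component_connected hG (hS.trans hB.subset) hc)
    set ε := P.highestRoot C with hε
    obtain ⟨h1, h2⟩ := Finset.mem_filter.mp hh.1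
    rcases (highest_dom' hG hB hCΔ hh hα hαC).lt_or_eq with hlt | heq
    · exact ⟨C, mem_cascadeAux_succ.mpr ⟨c, hc, Or.inl rfl⟩, hαC, hlt⟩
    · have hcard' : (P.zeroPart C).card < n := by
        have : (P.zeroPart C).card < C.card := by
          refine Finset.card_lt_card ⟨zeroPart_subset C, fun hsub => ?_⟩
          obtain ⟨m, hm⟩ := mem_NN.mp h2
          have e := pair_sum (hCΔ.trans hB.subset) h1 hm h1
          rw [P.pair_self _ h1, Finset.sum_eq_zero] at e
          · omega
          · intro a ha
            rw [(Finset.mem_filter.mp (hsub ha)).2, mul_zero]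
        have := Finset.card_le_card hCS
        omega
      have hαZ : α ∈ NN (P.zeroPart C) := by
        obtain ⟨m, hm⟩ := mem_NN.mp hαC
        rw [pair_sum (hCΔ.trans hB.subset) hα hm h1] at heq
        have hz := (Finset.sum_eq_zero_iff_of_nonneg fun a ha =>
          mul_nonneg (Int.natCast_nonneg _) (highest_dom hG hB hCΔ hh ha)).mp heq.symm
        refine mem_NN.mpr ⟨m, ?_⟩
        rw [hm]
        refine (Finset.sum_subset (zeroPart_subset C) fun a ha haZ => ?_).symm
        have h3 := hz a ha
        have h4 : P.pairInt a ε ≠ 0 := fun h => haZ (Finset.mem_filter.mpr ⟨ha, h⟩)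
        have h5 : m a = 0 := by
          rcases mul_eq_zero.mp h3 with h | h
          · exact_mod_cast h
          · exact absurd h h4
        rw [h5, zero_smul]
      obtain ⟨K, hK, h⟩ := ih ((zeroPart_subset C).trans hCΔ) hcard' α hα hαZ
      exact ⟨K, mem_cascadeAux_succ.mpr ⟨c, hc, Or.inr hK⟩, h⟩

lemma cascade_orth (hG : P.Good) (hB : P.IsBase Δ) (n : ℕ) : ∀ {S : Finset V}, S ⊆ Δ →
    ∀ K ∈ P.cascadeAux n S, ∀ L ∈ P.cascadeAux n S, K ≠ L →
    (∀ α ∈ P.roots, α ∈ NN L → P.pairInt α (P.highestRoot K) = 0) ∨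
    (∀ α ∈ P.roots, α ∈ NN K → P.pairInt α (P.highestRoot L) = 0) := by
  induction n with
  | zero => intro S _ K h; simp [cascadeAux] at h
  | succ n ih =>
    intro S hS K hK L hL hKL
    have hSr := hS.trans hB.subset
    have aux : ∀ C : Finset V, C ⊆ Δ → ∀ L ∈ P.cascadeAux n (P.zeroPart C),
        P.highestRoot C ∈ P.roots →
        ∀ α ∈ P.roots, α ∈ NN L → P.pairInt α (P.highestRoot C) = 0 := by
      intro C hC L hL hr α hα hαL
      have hLZ := (cascade_sub hG n (((zeroPart_subset C).trans hC).trans hB.subset) hL).1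
      obtain ⟨m, hm⟩ := mem_NN.mp hαL
      rw [pair_sum ((hLZ.trans (zeroPart_subset C)).trans (hC.trans hB.subset)) hα hm hr]
      refine Finset.sum_eq_zero fun a ha => ?_
      rw [(Finset.mem_filter.mp (hLZ ha)).2, mul_zero]
    obtain ⟨hKS, hKc⟩ := cascade_sub hG (n + 1) hSr hK
    obtain ⟨hLS, hLc⟩ := cascade_sub hG (n + 1) hSr hL
    obtain ⟨hKr, hKr'⟩ := Finset.mem_filter.mp (highest_spec hG hB (hKS.trans hS) hKc).1
    obtain ⟨hLr, hLr'⟩ := Finset.mem_filter.mp (highest_spec hG hB (hLS.trans hS) hLc).1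
    obtain ⟨c, hc, hKc'⟩ := mem_cascadeAux_succ.mp hK
    obtain ⟨d, hd, hLd'⟩ := mem_cascadeAux_succ.mp hL
    have hCΔ := (component_subset (P := P) S c).trans hS
    have hDΔ := (component_subset (P := P) S d).trans hS
    by_cases hCD : P.component S c = P.component S d
    · rw [← hCD] at hLd'
      rcases hKc' with h1 | h1 <;> rcases hLd' with h2 | h2
      · exact absurd (h1.trans h2.symm) hKL
      · left; rw [← h1] at h2
        exact aux K (hKS.trans hS) L h2 hKr
      · right; rw [← h2] at h1
        exact aux L (hLS.trans hS) K h1 hLr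
      · exact ih ((zeroPart_subset _).trans hCΔ) K h1 L h2 hKL
    · have sub : ∀ c K, c ∈ S → (K = P.component S c ∨
          K ∈ P.cascadeAux n (P.zeroPart (P.component S c))) → K ⊆ P.component S c := by
        intro c K _ h
        rcases h with rfl | h
        · exact subset_rfl
        · exact (cascade_sub hG n (((zeroPart_subset _).trans (component_subset _ _)).trans hSr)
            h).1.trans (zeroPart_subset _)
      have hKC := sub c K hc hKc'
      have hLD := sub d L hd hLd'
      left
      intro α hα hαL
      obtain ⟨m, hm⟩ := mem_NN.mp hαL
      rw [pair_sum (hLS.trans hSr) hα hm hKr]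
      refine Finset.sum_eq_zero fun b hb => ?_
      have hbR := hSr (hLS hb)
      rw [hG.symm_zero _ hKr _ hbR, mul_zero]
      obtain ⟨p, hp⟩ := mem_NN.mp hKr'
      rw [pair_sum (hKS.trans hSr) hKr hp hbR]
      refine Finset.sum_eq_zero fun a ha => ?_
      rw [component_orth hG hSr hCD (hKC ha) (hLD hb), mul_zero]

/-! ### Summary -/

lemma cascade_highest (hG : P.Good) (hB : P.IsBase Δ) {K : Finset V} (hK : K ∈ P.cascade Δ) :
    K ⊆ Δ ∧ P.IsHighestRoot K (P.highestRoot K) := by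
  obtain ⟨h1, h2⟩ := cascade_sub hG _ hB.subset hK
  exact ⟨h1, highest_spec hG hB h1 h2⟩

lemma cascade_mem_pos (hG : P.Good) (hB : P.IsBase Δ) {K : Finset V} (hK : K ∈ P.cascade Δ) :
    P.highestRoot K ∈ P.posRoots Δ := by
  obtain ⟨h1, h2⟩ := cascade_highest hG hB hK
  obtain ⟨h3, h4⟩ := Finset.mem_filter.mp h2.1
  exact Finset.mem_filter.mpr ⟨h3, NN_mono h1 h4⟩

lemma gamma_unique (hG : P.Good) (hB : P.IsBase Δ) {K L : Finset V} (hK : K ∈ P.cascade Δ)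
    (hL : L ∈ P.cascade Δ) {α : V} (hα : α ∈ P.roots) (h1 : α ∈ NN K) (h2 : α ∈ NN L)
    (h3 : 0 < P.pairInt α (P.highestRoot K)) (h4 : 0 < P.pairInt α (P.highestRoot L)) :
    K = L := by
  by_contra h
  rcases cascade_orth hG hB _ subset_rfl K hK L hL h with h | h
  · have := h α hα h2; omega
  · have := h α hα h1; omega

/-- if `β + α = ε_K` and `β + α' = ε_M` then `M = K`. -/
lemma cascade_add_unique (hG : P.Good) (hB : P.IsBase Δ) {K M : Finset V}
    (hK : K ∈ P.cascade Δ) (hM : M ∈ P.cascade Δ) {α α' β : V} (hα : α ∈ P.posRoots Δ)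
    (hα' : α' ∈ P.posRoots Δ) (hβ : β ∈ P.posRoots Δ) (h1 : α + β = P.highestRoot K)
    (h2 : α' + β = P.highestRoot M) : M = K := by
  obtain ⟨a1, a2⟩ := Finset.mem_filter.mp hα
  obtain ⟨b1, b2⟩ := Finset.mem_filter.mp hα'
  obtain ⟨c1, c2⟩ := Finset.mem_filter.mp hβ
  obtain ⟨k1, k2⟩ := cascade_highest hG hB hK
  obtain ⟨m1, m2⟩ := cascade_highest hG hB hM
  obtain ⟨e1, e2⟩ := highest_add hG hB k1 k2 c1 a1 c2 a2 (by rw [add_comm, h1])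
  obtain ⟨e3, e4⟩ := highest_add hG hB m1 m2 c1 b1 c2 b2 (by rw [add_comm, h2])
  exact gamma_unique hG hB hM hK c1 e3 e1 e4 e2

lemma cascade_add_ne (hG : P.Good) (hB : P.IsBase Δ) {K M : Finset V}
    (hK : K ∈ P.cascade Δ) (hM : M ∈ P.cascade Δ) {α : V} (hα : α ∈ P.posRoots Δ) :
    α + P.highestRoot M ≠ P.highestRoot K := by
  intro h
  obtain ⟨a1, a2⟩ := Finset.mem_filter.mp hα
  obtain ⟨c1, c2⟩ := Finset.mem_filter.mp (cascade_mem_pos hG hB hM)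
  obtain ⟨k1, k2⟩ := cascade_highest hG hB hK
  obtain ⟨m1, m2⟩ := cascade_highest hG hB hM
  obtain ⟨e1, e2⟩ := highest_add hG hB k1 k2 c1 a1 c2 a2 (by rw [add_comm, h])
  have : K = M := gamma_unique hG hB hK hM c1 e1 (Finset.mem_filter.mp m2.1).2 e2
    (by rw [P.pair_self _ c1]; norm_num)
  subst this
  exact P.ne_zero α a1 (by simpa using h)

lemma cascade_alt (hG : P.Good) (hB : P.IsBase Δ) {α : V} (hα : α ∈ P.posRoots Δ) :
    (∃ K ∈ P.cascade Δ, α = P.highestRoot K) ∨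
    ∃ β ∈ P.posRoots Δ, ∃ K ∈ P.cascade Δ, α + β = P.highestRoot K := by
  obtain ⟨a1, a2⟩ := Finset.mem_filter.mp hα
  obtain ⟨K, hK, h1, h2⟩ := cascade_cover hG hB (Δ.card + 1) subset_rfl (by omega) α a1 a2
  by_cases h : α = P.highestRoot K
  · exact Or.inl ⟨K, hK, h⟩
  right
  obtain ⟨k1, k2⟩ := cascade_highest hG hB hK
  have hKr := (Finset.mem_filter.mp k2.1).1
  refine ⟨P.highestRoot K - α, Finset.mem_filter.mpr ⟨?_, NN_mono k1 (k2.2 _ ?_)⟩, K, hK, by abel⟩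
  · exact hG.sub _ hKr _ a1 (hG.symm_pos _ a1 _ hKr h2) (Ne.symm h)
  · exact Finset.mem_filter.mpr ⟨a1, NN_le_ZZ K h1⟩

lemma cascade_indep (hG : P.Good) (hB : P.IsBase Δ) (c : Finset V → k)
    (h : ∑ K ∈ P.cascade Δ, c K • P.highestRoot K = 0) : ∀ K ∈ P.cascade Δ, c K = 0 := by
  intro L hL
  have hr : ∀ K ∈ P.cascade Δ, P.highestRoot K ∈ P.roots ∧ P.highestRoot K ∈ NN K := fun K hK =>
    Finset.mem_filter.mp (cascade_highest hG hB hK).2.1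
  have e := congrArg (P.corootForm (P.highestRoot L)) h
  rw [map_sum, map_zero, Finset.sum_eq_single L] at e
  · rw [map_smul, ← P.pair_compat _ (hr L hL).1 _ (hr L hL).1, P.pair_self _ (hr L hL).1] at e
    simpa using e
  · intro K hK hKL
    have : P.pairInt (P.highestRoot K) (P.highestRoot L) = 0 := by
      rcases cascade_orth hG hB _ subset_rfl K hK L hL hKL with h | h
      · exact hG.symm_zero _ (hr L hL).1 _ (hr K hK).1 (h _ (hr L hL).1 (hr L hL).2)
      · exact h _ (hr K hK).1 (hr K hK).2
    rw [map_smul, ← P.pair_compat _ (hr L hL).1 _ (hr K hK).1, this]; simp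
  · exact fun h => absurd hL h

lemma cascade_inj (hG : P.Good) (hB : P.IsBase Δ) {K L : Finset V} (hK : K ∈ P.cascade Δ)
    (hL : L ∈ P.cascade Δ) (h : P.highestRoot K = P.highestRoot L) : K = L := by
  obtain ⟨h1, h2⟩ := Finset.mem_filter.mp (cascade_highest hG hB hK).2.1
  obtain ⟨h3, h4⟩ := Finset.mem_filter.mp (cascade_highest hG hB hL).2.1
  refine gamma_unique hG hB hK hL h1 h2 (h ▸ h4) ?_ ?_
  · rw [P.pair_self _ h1]; norm_num
  · rw [h, P.pair_self _ h3]; norm_num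

end Comb

end RootSystemData


section LieLemmas

open LieAlgebra LieAlgebra.IsKilling LieModule

variable {k g : Type*} [Field k] [IsAlgClosed k] [CharZero k]
    [LieRing g] [LieAlgebra k g] [FiniteDimensional k g] [LieAlgebra.IsKilling k g]
    {H : LieSubalgebra k g} [H.IsCartanSubalgebra]

theorem cascadeLie_bracket_aux (α β : Weight k H g) (hα : α.IsNonZero) (hβ : β.IsNonZero)
    (hαβ : rootSpace H (-(α : H → k) + β) ≠ ⊥) {x y : g} (hx : x ∈ rootSpace H (-(α : H → k)))
    (hx0 : x ≠ 0) (hy : y ∈ rootSpace H (β : H → k)) (hy0 : y ≠ 0) : ⁅x, y⁆ ≠ 0 := by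
  obtain ⟨v, hv, v_ne0⟩ := (chainTop (α : H → k) β).exists_ne_zero
  obtain ⟨h, e, f, isSl2, he, hf⟩ := exists_isSl2Triple_of_weight_isNonZero hα
  obtain rfl := isSl2.h_eq_coroot hα he hf
  have prim : isSl2.HasPrimitiveVectorWith v (chainLength α β : k) :=
    have := lie_mem_genWeightSpace_of_mem_genWeightSpace he hv
    ⟨v_ne0, (chainLength_smul _ _ hv).symm, by rwa [genWeightSpace_add_chainTop _ _ hα] at this⟩
  have key : ∀ n : ℕ, -((n + chainTopCoeff (α : H → k) β) • (α : H → k)) + (chainTop (α : H → k) β)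
      = -(n • (α : H → k)) + β := by
    intro n
    rw [coe_chainTop']
    rw [add_smul]
    abel
  have hq : chainTopCoeff (α : H → k) β + 1 ≤ chainLength α β := by
    by_contra hcon
    apply hαβ
    have := rootSpace_neg_nsmul_add_chainTop_of_lt α β hα (n := 1 + chainTopCoeff (α : H → k) β)
      (by omega)
    rw [key 1, one_smul] at this
    exact this
  have hne := prim.pow_toEnd_f_ne_zero_of_eq_nat rfl hq
  have hne' := prim.pow_toEnd_f_ne_zero_of_eq_nat rfl (Nat.le_of_succ_le hq)
  have hmem := toEnd_pow_apply_mem hf hv (chainTopCoeff (α : H → k) β)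
  have hk0 := key 0
  rw [zero_add, zero_smul, neg_zero, zero_add] at hk0
  rw [smul_neg, hk0] at hmem
  set w := ((toEnd k g g f) ^ (chainTopCoeff (α : H → k) β)) v with hw
  rw [pow_succ', Module.End.mul_apply, ← hw, toEnd_apply_apply] at hne
  have d1 := finrank_rootSpace_eq_one β hβ
  have hnα : (-α).IsNonZero := hα.neg
  have d2 := finrank_rootSpace_eq_one (-α) hnα
  rw [Weight.coe_neg] at d2
  obtain ⟨c, hc⟩ := (finrank_eq_one_iff_of_nonzero' (⟨w, hmem⟩ : rootSpace H (β : H → k))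
    (by simpa using hne')).mp d1 ⟨y, hy⟩
  have hf0 : f ≠ 0 := isSl2.f_ne_zero
  obtain ⟨d, hd⟩ := (finrank_eq_one_iff_of_nonzero' (⟨f, hf⟩ : rootSpace H (-(α : H → k)))
    (by simpa using hf0)).mp d2 ⟨x, hx⟩
  have hc' : c • w = y := congrArg Subtype.val hc
  have hd' : d • f = x := congrArg Subtype.val hd
  have hd0 : d ≠ 0 := fun h => hx0 (by rw [← hd', h, zero_smul])
  have hc0 : c ≠ 0 := fun h => hy0 (by rw [← hc', h, zero_smul])
  rw [← hc', ← hd', smul_lie, lie_smul]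
  exact smul_ne_zero hd0 (smul_ne_zero hc0 hne)

theorem cascadeLie_bracket (α β : Module.Dual k H) (hα : α ≠ 0) (hβ : β ≠ 0)
    (hαr : rootSpace H ⇑α ≠ ⊥) (hβr : rootSpace H ⇑β ≠ ⊥)
    (hαβ : rootSpace H ⇑(α + β) ≠ ⊥) {x y : g} (hx : x ∈ rootSpace H ⇑α)
    (hx0 : x ≠ 0) (hy : y ∈ rootSpace H ⇑β) (hy0 : y ≠ 0) : ⁅x, y⁆ ≠ 0 := by
  let a : Weight k H g := ⟨⇑α, hαr⟩
  let b : Weight k H g := ⟨⇑β, hβr⟩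
  have ha : a.IsNonZero := fun h => hα (DFunLike.coe_injective h)
  have hb : b.IsNonZero := fun h => hβ (DFunLike.coe_injective h)
  have hca : -((-a : Weight k H g) : H → k) = ⇑α := by rw [Weight.coe_neg, neg_neg]; rfl
  refine cascadeLie_bracket_aux (-a) b ha.neg hb ?_ ?_ hx0 hy hy0
  · rw [hca]; exact hαβ
  · rw [hca]; exact hx

theorem cascadeLie_ker {x : g} (h : ∀ y, killingForm k g x y = 0) : x = 0 := by
  have : x ∈ LinearMap.ker (killingForm k g) := by
    rw [LinearMap.mem_ker]; ext y; exact h y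
  rwa [LieAlgebra.IsKilling.ker_killingForm_eq_bot] at this

theorem cascadeLie_pair (α : Module.Dual k H) (hα : α ≠ 0)
    (hαr : rootSpace H ⇑α ≠ ⊥) {x y : g} (hx : x ∈ rootSpace H ⇑(-α))
    (hx0 : x ≠ 0) (hy : y ∈ rootSpace H ⇑α) (hy0 : y ≠ 0) : killingForm k g x y ≠ 0 := by
  intro h
  let a : Weight k H g := ⟨⇑α, hαr⟩
  have ha : a.IsNonZero := fun h => hα (DFunLike.coe_injective h)
  apply hx0
  have := mem_ker_killingForm_of_mem_rootSpace_of_forall_rootSpace_neg k g H hx (by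
    intro z hz
    have e : -⇑(-α) = ⇑α := by ext t; simp
    rw [e] at hz
    obtain ⟨c, hc⟩ := (finrank_eq_one_iff_of_nonzero' (⟨y, hy⟩ : rootSpace H (a : H → k))
      (by simpa using hy0)).mp (finrank_rootSpace_eq_one a ha) ⟨z, hz⟩
    have hc' : c • y = z := congrArg Subtype.val hc
    rw [← hc', map_smul, h, smul_zero])
  rwa [LieAlgebra.IsKilling.ker_killingForm_eq_bot] at this

theorem cascadeLie_cartan {x : g} (hx : x ∈ H) (h : ∀ t ∈ H, killingForm k g x t = 0) :
    x = 0 := by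
  have hx' : x ∈ rootSpace H (0 : H → k) := by
    rw [← LieSubalgebra.mem_toSubmodule] at hx
    simpa using hx
  have := mem_ker_killingForm_of_mem_rootSpace_of_forall_rootSpace_neg k g H hx' (by
    intro z hz
    apply h
    simpa using hz)
  rwa [LieAlgebra.IsKilling.ker_killingForm_eq_bot] at this

theorem cascadeLie_good (P : RootSystemData k (Module.Dual k H))
    (hroots : ∀ α : Module.Dual k H, α ∈ P.roots ↔ α ≠ 0 ∧ rootSpace H ⇑α ≠ ⊥) : P.Good := by
  have hidx : ∀ α ∈ P.roots, ∃ i : H.root, (rootSystem H).root i = α := by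
    intro α hα
    obtain ⟨h0, hr⟩ := (hroots α).mp hα
    let a : Weight k H g := ⟨⇑α, hr⟩
    have ha : a.IsNonZero := fun h => h0 (DFunLike.coe_injective h)
    refine ⟨⟨a, by simpa using ha⟩, ?_⟩
    rw [rootSystem_root_apply]
    ext t; rfl
  have hmem : ∀ i : H.root, (rootSystem H).root i ∈ P.roots := by
    intro i
    rw [hroots]
    refine ⟨(rootSystem H).ne_zero i, ?_⟩
    rw [rootSystem_root_apply]
    exact i.1.2
  have hco : ∀ i : H.root, P.corootForm ((rootSystem H).root i)
      = (rootSystem H).toLinearMap.flip ((rootSystem H).coroot i) := by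
    intro i
    refine Module.Dual.eq_of_preReflection_mapsTo (x := (rootSystem H).root i)
      (Φ := (P.roots : Set _)) P.roots.finite_toSet P.span_eq_top ?_ ?_ ?_ ?_
    · rw [← P.pair_compat _ (hmem i) _ (hmem i), P.pair_self _ (hmem i)]; norm_num
    · intro β hβ
      rw [Module.preReflection_apply, ← P.pair_compat _ (hmem i) _ hβ, Int.cast_smul_eq_zsmul]
      exact P.reflect_mem _ (hmem i) _ hβ
    · exact (rootSystem H).root_coroot_two i
    · intro β hβ
      obtain ⟨j, rfl⟩ := hidx β hβ
      have := (rootSystem H).mapsTo_reflection_root i (Set.mem_range_self j)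
      obtain ⟨l, hl⟩ := this
      have h2 := hmem l
      rw [hl] at h2
      exact h2
  have hpair : ∀ i j : H.root, P.pairInt ((rootSystem H).root j) ((rootSystem H).root i)
      = (rootSystem H).pairingIn ℤ j i := by
    intro i j
    have h1 := P.pair_compat _ (hmem i) _ (hmem j)
    rw [hco] at h1
    have h2 := (rootSystem H).algebraMap_pairingIn ℤ j i
    have : ((P.pairInt ((rootSystem H).root j) ((rootSystem H).root i) : ℤ) : k)
      = (((rootSystem H).pairingIn ℤ j i : ℤ) : k) := by
      rw [h1]; exact h2.symm
    exact_mod_cast this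
  refine ⟨?_, ?_, ?_⟩
  · intro α hα β hβ hp hne
    obtain ⟨i, rfl⟩ := hidx α hα
    obtain ⟨j, rfl⟩ := hidx β hβ
    rw [hpair] at hp
    obtain ⟨l, hl⟩ := (rootSystem H).root_sub_root_mem_of_pairingIn_pos hp
      (fun h => hne (by rw [h]))
    rw [← hl]
    exact hmem l
  · intro α hα β hβ hp
    obtain ⟨i, rfl⟩ := hidx α hα
    obtain ⟨j, rfl⟩ := hidx β hβ
    rw [hpair] at hp ⊢
    exact ((rootSystem H).zero_lt_pairingIn_iff' ℤ).mp hp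
  · intro α hα β hβ hp
    obtain ⟨i, rfl⟩ := hidx α hα
    obtain ⟨j, rfl⟩ := hidx β hβ
    rw [hpair] at hp ⊢
    exact (rootSystem H).pairingIn_eq_zero_iff.mp hp

end LieLemmas

section LieTheory

open LieAlgebra

set_option maxHeartbeats 4000000

/-- Let `𝔤` be a finite-dimensional semisimple Lie algebra over an
algebraically closed field `k` of characteristic `0`, with Cartan subalgebra `𝔥`, root
system `R ⊆ 𝔥*`, base `Π`, positive roots `R₊`, `𝔫 = ⊕_{α ∈ R₊} 𝔤^α`, `𝔟 = 𝔥 ⊕ 𝔫` and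
Killing form `L`.  Fix nonzero root vectors `X_α ∈ 𝔤^α`, set `u = Σ_{K ∈ 𝒦} X_{-ε_K}`
where `𝒦 = 𝒦(Π)`, and let `f ∈ 𝔟*` be defined by `f x = L (u, x)`.  Then
`𝔟^f = {x ∈ 𝔥 : ε_K x = 0 for all K ∈ 𝒦}` and `[𝔟, 𝔟^f] ∩ 𝔟^f = {0}`. -/
theorem killing_form_of_cascade_sum_is_stable
    (k g : Type*) [Field k] [IsAlgClosed k] [CharZero k]
    [LieRing g] [LieAlgebra k g] [FiniteDimensional k g] [LieAlgebra.IsSemisimple k g]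
    (H : LieSubalgebra k g) [H.IsCartanSubalgebra]
    (P : RootSystemData k (Module.Dual k H))
    (hroots : ∀ α : Module.Dual k H, α ∈ P.roots ↔ α ≠ 0 ∧ rootSpace H ⇑α ≠ ⊥)
    (Δ : Finset (Module.Dual k H)) (hbase : P.IsBase Δ)
    (X : Module.Dual k H → g)
    (hX : ∀ α ∈ P.roots, X α ∈ rootSpace H ⇑α ∧ X α ≠ 0)
    (u : g) (hu : u = ∑ K ∈ P.cascade Δ, X (-P.highestRoot K))
    (b : LieSubalgebra k g)
    (hb : b.toSubmodule = H.toSubmodule ⊔ ⨆ α ∈ P.posRoots Δ, (rootSpace H ⇑α).toSubmodule)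
    (f : Module.Dual k b)
    (hf : ∀ x : b, f x = killingForm k g u (x : g)) :
    (∀ x : b, x ∈ lieSubFix b f ↔
      ∃ hxH : (x : g) ∈ H, ∀ K ∈ P.cascade Δ, P.highestRoot K ⟨(x : g), hxH⟩ = 0) ∧
    Submodule.span k {z : b | ∃ x : b, ∃ y ∈ lieSubFix b f, z = ⁅x, y⁆} ⊓ lieSubFix b f = ⊥ := by
  have hKil : LieAlgebra.IsKilling k g := inferInstance
  have hG : P.Good := cascadeLie_good P hroots
  have hpos : ∀ α ∈ P.posRoots Δ, α ∈ P.roots := fun α hα => (Finset.mem_filter.mp hα).1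
  have hε : ∀ K ∈ P.cascade Δ, P.highestRoot K ∈ P.posRoots Δ := fun K hK =>
    RootSystemData.cascade_mem_pos hG hbase hK
  have hH0 : ∀ t : g, t ∈ H ↔ t ∈ rootSpace H (⇑(0 : Module.Dual k H)) := by
    intro t
    have : (⇑(0 : Module.Dual k H)) = (0 : H → k) := rfl
    rw [this]
    simp
  -- the Killing form against `u` on root spaces
  have hXn : ∀ K ∈ P.cascade Δ, X (-P.highestRoot K) ∈ rootSpace H ⇑(-P.highestRoot K) ∧
      X (-P.highestRoot K) ≠ 0 := fun K hK =>
    hX _ (RootSystemData.neg_mem (hpos _ (hε K hK)))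
  have hL0 : ∀ K ∈ P.cascade Δ, ∀ γ : Module.Dual k H, γ ≠ P.highestRoot K →
      ∀ z ∈ rootSpace H ⇑γ, killingForm k g (X (-P.highestRoot K)) z = 0 := by
    intro K hK γ hγ z hz
    refine LieAlgebra.killingForm_apply_eq_zero_of_mem_rootSpace_of_add_ne_zero k g H
      (hXn K hK).1 hz ?_
    intro h
    apply hγ
    have h' : -P.highestRoot K + γ = 0 := DFunLike.coe_injective h
    exact (neg_add_eq_zero.mp h').symm
  have hB1 : ∀ γ : Module.Dual k H, (∀ K ∈ P.cascade Δ, γ ≠ P.highestRoot K) →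
      ∀ z ∈ rootSpace H ⇑γ, killingForm k g u z = 0 := by
    intro γ hγ z hz
    rw [hu, map_sum, LinearMap.sum_apply]
    exact Finset.sum_eq_zero fun K hK => hL0 K hK γ (hγ K hK) z hz
  have hB2 : ∀ K ∈ P.cascade Δ, ∀ z ∈ rootSpace H ⇑(P.highestRoot K),
      killingForm k g u z = killingForm k g (X (-P.highestRoot K)) z := by
    intro K hK z hz
    rw [hu, map_sum, LinearMap.sum_apply]
    refine Finset.sum_eq_single K (fun M hM hMK => hL0 M hM _ ?_ z hz) (fun h => absurd hK h)
    intro h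
    exact hMK (RootSystemData.cascade_inj hG hbase hK hM h).symm
  have hB3 : ∀ K ∈ P.cascade Δ, ∀ z ∈ rootSpace H ⇑(P.highestRoot K),
      killingForm k g u z = 0 → z = 0 := by
    intro K hK z hz h
    by_contra hz0
    rw [hB2 K hK z hz] at h
    obtain ⟨h1, h2⟩ := (hroots _).mp (hpos _ (hε K hK))
    exact cascadeLie_pair _ h1 h2 (hXn K hK).1 (hXn K hK).2 hz hz0 h
  have hBH : ∀ t ∈ H, killingForm k g u t = 0 := by
    intro t ht
    exact hB1 0 (fun K hK h => P.ne_zero _ (hpos _ (hε K hK)) h.symm) t ((hH0 t).mp ht)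
  have hact : ∀ (α : Module.Dual k H) (t : g) (ht : t ∈ H), ∀ z ∈ rootSpace H ⇑α,
      ⁅t, z⁆ = α ⟨t, ht⟩ • z := fun α t ht z hz =>
    LieAlgebra.IsKilling.lie_eq_smul_of_mem_rootSpace hz ⟨t, ht⟩
  have hHb : ∀ t ∈ H, t ∈ b := by
    intro t ht
    rw [← LieSubalgebra.mem_toSubmodule, hb]
    exact Submodule.mem_sup_left ht
  have hαb : ∀ α ∈ P.posRoots Δ, ∀ z ∈ rootSpace H ⇑α, z ∈ b := by
    intro α hα z hz
    rw [← LieSubalgebra.mem_toSubmodule, hb]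
    exact Submodule.mem_sup_right (Submodule.mem_iSup_of_mem α (Submodule.mem_iSup_of_mem hα hz))
  have hdec : ∀ x ∈ b, ∃ h ∈ H, ∃ y : Module.Dual k H → g,
      (∀ α : Module.Dual k H, y α ∈ rootSpace H ⇑α) ∧ x = h + ∑ α ∈ P.posRoots Δ, y α := by
    intro x hx
    rw [← LieSubalgebra.mem_toSubmodule, hb] at hx
    obtain ⟨h, hh, n, hn, rfl⟩ := Submodule.mem_sup.mp hx
    obtain ⟨μ, rfl⟩ := (Submodule.mem_iSup_finset_iff_exists_sum _ _).mp hn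
    exact ⟨h, hh, fun α => μ α, fun α => (μ α).2, rfl⟩
  have hlieH : ∀ s ∈ H, ∀ t ∈ H, ⁅s, t⁆ = 0 := by
    intro s hs t ht
    rw [hact 0 s hs t ((hH0 t).mp ht)]
    simp
  have main : ∀ x : b, x ∈ lieSubFix b f ↔
      ∃ hxH : (x : g) ∈ H, ∀ K ∈ P.cascade Δ, P.highestRoot K ⟨(x : g), hxH⟩ = 0 := by
    rintro ⟨x, hxb⟩
    constructor
    · intro hx
      have hfx : ∀ z ∈ b, killingForm k g u ⁅x, z⁆ = 0 := by
        intro z hz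
        have h1 := hx ⟨z, hz⟩
        rw [hf] at h1
        exact h1
      obtain ⟨h, hh, y, hy, hxy⟩ := hdec x hxb
      -- components at non-cascade roots vanish
      have step1 : ∀ α ∈ P.posRoots Δ, (∀ K ∈ P.cascade Δ, α ≠ P.highestRoot K) → y α = 0 := by
        intro α hα hne
        rcases RootSystemData.cascade_alt hG hbase hα with ⟨K, hK, hαK⟩ | ⟨β, hβ, K, hK, hsum⟩
        · exact absurd hαK (hne K hK)
        by_contra hy0
        obtain ⟨hz, hz0⟩ := hX β (hpos β hβ)
        have h1 := hfx (X β) (hαb β hβ _ hz)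
        rw [hxy, add_lie, map_add, hact β h hh _ hz, map_smul,
          hB1 β (fun M hM hβM => RootSystemData.cascade_add_ne hG hbase hK hM hα (by rw [← hβM, hsum])) _ hz,
          smul_zero, zero_add, ← lie_skew, map_neg, neg_eq_zero, lie_sum, map_sum,
          Finset.sum_eq_single α] at h1
        · have hm := LieAlgebra.lie_mem_genWeightSpace_of_mem_genWeightSpace hz (hy α)
          have hm' : ⁅X β, y α⁆ ∈ rootSpace H ⇑(P.highestRoot K) := by
            rw [← hsum, add_comm]; exact hm
          obtain ⟨e1, e2⟩ := (hroots _).mp (hpos _ hα)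
          obtain ⟨e3, e4⟩ := (hroots _).mp (hpos _ hβ)
          obtain ⟨e5, e6⟩ := (hroots _).mp (hpos _ (hε K hK))
          rw [← hsum, add_comm] at e6
          exact cascadeLie_bracket β α e3 e1 e4 e2 e6 hz hz0 (hy α) hy0 (hB3 K hK _ hm' h1)
        · intro α' hα' hαα'
          have hm := LieAlgebra.lie_mem_genWeightSpace_of_mem_genWeightSpace hz (hy α')
          refine hB1 (β + α') (fun M hM h => hαα' ?_) _ hm
          rw [add_comm] at h
          have hMK := RootSystemData.cascade_add_unique hG hbase hK hM hα hα' hβ hsum h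
          rw [hMK, ← hsum] at h
          exact add_right_cancel h
        · exact fun h => absurd hα h
      have step2 : ∀ K ∈ P.cascade Δ, killingForm k g u (y (P.highestRoot K)) = 0 := by
        refine RootSystemData.cascade_indep hG hbase (fun K => killingForm k g u (y (P.highestRoot K))) ?_
        ext ⟨t, ht⟩
        have h1 := hfx t (hHb t ht)
        rw [hxy, ← lie_skew, map_neg, neg_eq_zero, lie_add, hlieH t ht h hh, zero_add, lie_sum,
          map_sum] at h1
        have h2 : ∑ α ∈ P.posRoots Δ, killingForm k g u ⁅t, y α⁆
            = ∑ α ∈ (P.cascade Δ).image P.highestRoot, killingForm k g u ⁅t, y α⁆ := by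
          refine (Finset.sum_subset ?_ ?_).symm
          · intro α hα
            obtain ⟨K, hK, rfl⟩ := Finset.mem_image.mp hα
            exact hε K hK
          · intro α hα hα'
            rw [step1 α hα (fun K hK h => hα' (Finset.mem_image.mpr ⟨K, hK, h.symm⟩)), lie_zero,
              map_zero]
        rw [h2, Finset.sum_image (fun K hK L hL h => RootSystemData.cascade_inj hG hbase hK hL h)] at h1
        rw [LinearMap.sum_apply, LinearMap.zero_apply, ← h1]
        refine Finset.sum_congr rfl fun K hK => ?_
        rw [hact _ t ht _ (hy _), map_smul, LinearMap.smul_apply, smul_eq_mul, smul_eq_mul, mul_comm]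
      have step3 : ∀ α ∈ P.posRoots Δ, y α = 0 := by
        intro α hα
        by_cases hc : ∃ K ∈ P.cascade Δ, α = P.highestRoot K
        · obtain ⟨K, hK, rfl⟩ := hc
          exact hB3 K hK _ (hy _) (step2 K hK)
        · exact step1 α hα (fun K hK h => hc ⟨K, hK, h⟩)
      have hxh : x = h := by rw [hxy, Finset.sum_eq_zero step3, add_zero]
      subst hxh
      refine ⟨hh, fun K hK => ?_⟩
      obtain ⟨hz, hz0⟩ := hX _ (hpos _ (hε K hK))
      have h1 := hfx _ (hαb _ (hε K hK) _ hz)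
      rw [hact _ x hh _ hz, map_smul, smul_eq_mul] at h1
      rcases mul_eq_zero.mp h1 with h2 | h2
      · exact h2
      · exact absurd (hB3 K hK _ hz h2) hz0
    · rintro ⟨hxH, hx⟩ ⟨z, hz⟩
      rw [hf]
      change killingForm k g u ⁅x, z⁆ = 0
      have h0 : ⁅u, x⁆ = 0 := by
        rw [← lie_skew, neg_eq_zero, hu, lie_sum]
        refine Finset.sum_eq_zero fun K hK => ?_
        rw [hact _ x hxH _ (hXn K hK).1, LinearMap.neg_apply, hx K hK, neg_zero, zero_smul]
      rw [← LieModule.traceForm_apply_lie_apply, h0, map_zero, LinearMap.zero_apply]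
  refine ⟨main, ?_⟩
  rw [eq_bot_iff]
  rintro z ⟨hz1, hz2⟩
  let n : Submodule k g := ⨆ α ∈ P.posRoots Δ, (rootSpace H ⇑α).toSubmodule
  have hle : Submodule.span k {z : b | ∃ x : b, ∃ y ∈ lieSubFix b f, z = ⁅x, y⁆}
      ≤ n.comap b.toSubmodule.subtype := by
    rw [Submodule.span_le]
    rintro _ ⟨x, t, ht, rfl⟩
    obtain ⟨htH, -⟩ := (main t).mp ht
    change ⁅(x : g), (t : g)⁆ ∈ n
    obtain ⟨h, hh, y, hy, hxy⟩ := hdec x x.2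
    rw [hxy, ← lie_skew, lie_add, hlieH _ htH h hh, zero_add, lie_sum]
    refine n.neg_mem (n.sum_mem fun α hα => ?_)
    rw [hact α _ htH _ (hy α)]
    exact Submodule.mem_iSup_of_mem α
      (Submodule.mem_iSup_of_mem hα ((rootSpace H ⇑α).smul_mem _ (hy α)))
  have hzn : (z : g) ∈ n := hle hz1
  obtain ⟨hzH, -⟩ := (main z).mp hz2
  have hz0 : (z : g) = 0 := by
    refine cascadeLie_cartan hzH fun t ht => ?_
    obtain ⟨μ, hμ⟩ := (Submodule.mem_iSup_finset_iff_exists_sum _ _).mp hzn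
    rw [← hμ, map_sum, LinearMap.sum_apply]
    refine Finset.sum_eq_zero fun α hα => ?_
    refine LieAlgebra.killingForm_apply_eq_zero_of_mem_rootSpace_of_add_ne_zero k g H
      (μ α).2 ((hH0 t).mp ht) ?_
    intro h
    have h' : α + 0 = 0 := DFunLike.coe_injective h
    exact P.ne_zero α (hpos α hα) (by rwa [add_zero] at h')
  exact (Submodule.mem_bot k).mpr (Subtype.ext hz0)

end LieTheory
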